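/- Let n ≥ 2 and let Q be a nonzero real symmetric n×n matrix. Let ε ∈ (0, √2·K(Q)] and φ ∈ (0,1), and let M be a positive integer with M ≥ m( (ε/(√2·K(Q)))^{n-1}, φ ). If δ_1, …, δ_M are independent random vectors each uniformly distributed on Δ^{n-1}, then with probability at least 1 − φ it holds that min_{1≤i≤M} δ_i^T Q δ_i − γ(Q) ≤ ε. -/

import Mathlib

open MeasureTheory Matrix

/-- The standard simplex `Δ^{n-1}`, viewed inside Euclidean space (so that the metric,
and hence the Hausdorff measure, is the Euclidean one). -/
def stdSimplexE (n : ℕ) : Set (EuclideanSpace ℝ (Fin n)) :=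
  {δ | (∀ i, 0 ≤ δ i) ∧ ∑ i, δ i = 1}

/-- The uniform distribution on the standard simplex: the `(n-1)`-dimensional Hausdorff
measure restricted to the simplex and normalized to a probability measure. -/
noncomputable def uniformSimplex (n : ℕ) : Measure (EuclideanSpace ℝ (Fin n)) :=
  (μH[(n : ℝ) - 1] (stdSimplexE n))⁻¹ • (μH[(n : ℝ) - 1]).restrict (stdSimplexE n)

lemma isCompact_stdSimplexE (n : ℕ) : IsCompact (stdSimplexE n) := by
  have h : stdSimplexE n = (WithLp.toLp 2) '' stdSimplex ℝ (Fin n) := by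
    ext x
    constructor
    · intro hx
      exact ⟨x.ofLp, hx, rfl⟩
    · rintro ⟨y, hy, rfl⟩
      exact hy
  rw [h]
  exact (isCompact_stdSimplex ℝ (Fin n)).image (PiLp.continuous_toLp 2 _)

lemma stdSimplexE_nonempty {n : ℕ} (hn : 0 < n) : (stdSimplexE n).Nonempty :=
  ⟨WithLp.toLp 2 (Pi.single ⟨0, hn⟩ 1), single_mem_stdSimplex ℝ (⟨0, hn⟩ : Fin n)⟩

lemma convex_stdSimplexE (n : ℕ) : Convex ℝ (stdSimplexE n) := by
  rintro x ⟨hx, hx1⟩ y ⟨hy, hy1⟩ a b ha hb hab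
  refine ⟨fun i => ?_, ?_⟩
  · have := mul_nonneg ha (hx i)
    have := mul_nonneg hb (hy i)
    simp only [PiLp.add_apply, PiLp.smul_apply, smul_eq_mul]
    positivity
  · simp [Finset.sum_add_distrib, ← Finset.mul_sum, hx1, hy1, hab]

lemma hausdorffMeasure_stdSimplexE_pos (m : ℕ) : 0 < μH[(m : ℝ)] (stdSimplexE (m + 1)) := by
  let p : EuclideanSpace ℝ (Fin (m + 1)) → (Fin m → ℝ) := fun x i => x i.succ
  have hp : LipschitzWith 1 p := by
    refine LipschitzWith.of_dist_le_mul fun x y => ?_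
    rw [NNReal.coe_one, one_mul, dist_pi_le_iff dist_nonneg]
    intro i
    rw [dist_eq_norm, dist_eq_norm]
    exact PiLp.norm_apply_le (x - y) i.succ
  let U : Set (Fin m → ℝ) := Set.univ.pi fun _ => Set.Ioo 0 (1 / ((m : ℝ) + 1))
  have hU : U ⊆ p '' stdSimplexE (m + 1) := by
    intro y hy
    have hy' : ∀ i, 0 < y i ∧ y i < 1 / ((m : ℝ) + 1) := fun i => hy i trivial
    have hs : ∑ i, y i ≤ 1 := by
      calc ∑ i, y i ≤ ∑ _i : Fin m, 1 / ((m : ℝ) + 1) :=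
            Finset.sum_le_sum fun i _ => (hy' i).2.le
        _ ≤ 1 := by
            have : (0 : ℝ) < (m : ℝ) + 1 := by positivity
            simp only [Finset.sum_const, Finset.card_univ, Fintype.card_fin, nsmul_eq_mul]
            rw [mul_one_div, div_le_one this]
            linarith
    refine ⟨WithLp.toLp 2 (Fin.cons (1 - ∑ i, y i) y), ⟨fun i => ?_, ?_⟩, ?_⟩
    · refine Fin.cases ?_ (fun j => ?_) i
      · simpa using hs
      · simpa using (hy' j).1.le
    · simp [Fin.sum_univ_succ]
    · ext i
      simp [p]
  have hUpos : 0 < volume U := by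
    refine IsOpen.measure_pos _ (isOpen_set_pi Set.finite_univ fun _ _ => isOpen_Ioo) ?_
    refine Set.univ_pi_nonempty_iff.2 fun _ => Set.nonempty_Ioo.2 (by positivity)
  have h := hp.hausdorffMeasure_image_le (d := (m : ℝ)) (by positivity) (stdSimplexE (m + 1))
  have hvol : (μH[(m : ℝ)] : Measure (Fin m → ℝ)) = volume := by
    simpa using (hausdorffMeasure_pi_real (ι := Fin m))
  rw [hvol] at h
  simpa using (hUpos.trans_le (measure_mono hU)).trans_le h

lemma hausdorffMeasure_stdSimplexE_lt_top (m : ℕ) :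
    μH[(m : ℝ)] (stdSimplexE (m + 1)) < ⊤ := by
  let L : (Fin m → ℝ) →ₗ[ℝ] EuclideanSpace ℝ (Fin (m + 1)) :=
    { toFun := fun y => WithLp.toLp 2 (Fin.cons (-∑ i, y i) y)
      map_add' := fun x y => by
        ext i
        refine Fin.cases ?_ (fun j => ?_) i
        · simp [Finset.sum_add_distrib]; ring
        · simp
      map_smul' := fun c y => by
        ext i
        refine Fin.cases ?_ (fun j => ?_) i
        · simp [Finset.mul_sum]
        · simp }
  let e : EuclideanSpace ℝ (Fin (m + 1)) := EuclideanSpace.single 0 1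
  have hL := (LinearMap.toContinuousLinearMap L).lipschitz
  have hg := hL.add (LipschitzWith.const (α := Fin m → ℝ) e)
  have hsub : stdSimplexE (m + 1) ⊆
      (fun y => LinearMap.toContinuousLinearMap L y + e) '' Set.Icc 0 1 := by
    rintro x ⟨hx, hx1⟩
    refine ⟨fun i => x i.succ, ⟨fun i => hx _, fun i => ?_⟩, ?_⟩
    · rw [Pi.one_apply, ← hx1]
      exact Finset.single_le_sum (fun j _ => hx j) (Finset.mem_univ i.succ)
    · ext i
      rw [Fin.sum_univ_succ] at hx1
      refine Fin.cases ?_ (fun j => ?_) i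
      · simp [L, e]; linarith
      · simp [L, e]
  have hvol : (μH[(m : ℝ)] : Measure (Fin m → ℝ)) = volume := by
    simpa using (hausdorffMeasure_pi_real (ι := Fin m))
  refine (measure_mono hsub).trans_lt ?_
  refine (hg.hausdorffMeasure_image_le (d := (m : ℝ)) (by positivity) _).trans_lt ?_
  rw [hvol]
  exact ENNReal.mul_lt_top (ENNReal.rpow_lt_top_of_nonneg (by positivity) ENNReal.coe_ne_top)
    isCompact_Icc.measure_lt_top

lemma isProbabilityMeasure_uniformSimplex {n : ℕ} (hn : 0 < n) :
    IsProbabilityMeasure (uniformSimplex n) := by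
  obtain ⟨m, rfl⟩ := Nat.exists_eq_succ_of_ne_zero hn.ne'
  refine ⟨?_⟩
  have hpos := hausdorffMeasure_stdSimplexE_pos m
  have htop := hausdorffMeasure_stdSimplexE_lt_top m
  have hm : ((m.succ : ℕ) : ℝ) - 1 = m := by push_cast; ring
  simp only [uniformSimplex, hm, Measure.smul_apply, Measure.restrict_apply_univ, smul_eq_mul]
  exact ENNReal.inv_mul_cancel hpos.ne' htop.ne

/-- The homothetic copy of the simplex, centered at one of its points with ratio `t ∈ (0, 1]`,
has probability `t ^ (n - 1)`. -/
lemma uniformSimplex_homothety {n : ℕ} (hn : 0 < n) {x : EuclideanSpace ℝ (Fin n)}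
    (hx : x ∈ stdSimplexE n) {t : ℝ} (ht0 : 0 < t) (ht1 : t ≤ 1) :
    uniformSimplex n (AffineMap.homothety x t '' stdSimplexE n) =
      ENNReal.ofReal (t ^ (n - 1)) := by
  obtain ⟨m, rfl⟩ := Nat.exists_eq_succ_of_ne_zero hn.ne'
  have hpos := hausdorffMeasure_stdSimplexE_pos m
  have htop := hausdorffMeasure_stdSimplexE_lt_top m
  have hm : ((m.succ : ℕ) : ℝ) - 1 = m := by push_cast; ring
  have hsub : AffineMap.homothety x t '' stdSimplexE m.succ ⊆ stdSimplexE m.succ := by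
    rintro _ ⟨z, hz, rfl⟩
    rw [AffineMap.homothety_eq_lineMap]
    exact (convex_stdSimplexE _).lineMap_mem hx hz ⟨ht0.le, ht1⟩
  have hmeas : MeasurableSet (AffineMap.homothety x t '' stdSimplexE m.succ) :=
    ((isCompact_stdSimplexE _).image (AffineMap.homothety_continuous x t)).measurableSet
  simp only [uniformSimplex, hm, Measure.smul_apply, Measure.restrict_apply hmeas, smul_eq_mul,
    Set.inter_eq_left.2 hsub]
  rw [hausdorffMeasure_homothety_image (by positivity) x ht0.ne', ENNReal.smul_def, smul_eq_mul,
    mul_left_comm, ENNReal.inv_mul_cancel hpos.ne' htop.ne, mul_one, NNReal.rpow_natCast,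
    ENNReal.coe_pow, ← enorm_eq_nnnorm, Real.enorm_eq_ofReal ht0.le, ENNReal.ofReal_pow ht0.le,
    Nat.succ_sub_one]

lemma sum_sub_sq_le_two {n : ℕ} {x z : EuclideanSpace ℝ (Fin n)}
    (hx : x ∈ stdSimplexE n) (hz : z ∈ stdSimplexE n) : ∑ k, (z k - x k) ^ 2 ≤ 2 := by
  have hle : ∀ {y : EuclideanSpace ℝ (Fin n)}, y ∈ stdSimplexE n → ∀ i, y i ≤ 1 := by
    rintro y ⟨hy, hy1⟩ i
    rw [← hy1]
    exact Finset.single_le_sum (fun j _ => hy j) (Finset.mem_univ i)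
  calc ∑ k, (z k - x k) ^ 2 ≤ ∑ k, (z k + x k) := by
        refine Finset.sum_le_sum fun k _ => ?_
        nlinarith [hx.1 k, hz.1 k, hle hx k, hle hz k, mul_nonneg (hx.1 k) (hz.1 k)]
    _ = 2 := by rw [Finset.sum_add_distrib, hx.2, hz.2]; norm_num

lemma sub_dotProduct_mulVec_le {n : ℕ} (Q : Matrix (Fin n) (Fin n) ℝ)
    {x z w : EuclideanSpace ℝ (Fin n)} (hx : x ∈ stdSimplexE n) (hz : z ∈ stdSimplexE n)
    (hw : w ∈ stdSimplexE n) :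
    (z.ofLp - x.ofLp) ⬝ᵥ Q *ᵥ w.ofLp ≤ √2 * ⨆ i : Fin n, √(∑ k, (Q k i) ^ 2) := by
  set B := ⨆ i : Fin n, √(∑ k, (Q k i) ^ 2)
  have hcol : ∀ j, ∑ k, (z k - x k) * Q k j ≤ √2 * B := fun j =>
    calc ∑ k, (z k - x k) * Q k j ≤ √(∑ k, (z k - x k) ^ 2) * √(∑ k, Q k j ^ 2) :=
          Real.sum_mul_le_sqrt_mul_sqrt _ _ _
      _ ≤ √2 * B := by
          gcongr
          · exact sum_sub_sq_le_two hx hz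
          · exact le_ciSup (f := fun i => √(∑ k, (Q k i) ^ 2)) (Set.finite_range _).bddAbove j
  calc (z.ofLp - x.ofLp) ⬝ᵥ Q *ᵥ w.ofLp = ∑ j, w j * ∑ k, (z k - x k) * Q k j := by
        simp only [dotProduct, mulVec, Pi.sub_apply, Finset.mul_sum]
        rw [Finset.sum_comm]
        exact Finset.sum_congr rfl fun _ _ => Finset.sum_congr rfl fun _ _ => by ring
    _ ≤ ∑ j, w j * (√2 * B) :=
        Finset.sum_le_sum fun j _ => mul_le_mul_of_nonneg_left (hcol j) (hw.1 j)
    _ = √2 * B := by rw [← Finset.sum_mul, hw.2, one_mul]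

/-- Moving from `x` a fraction `t` of the way to `z` within the simplex increases the quadratic
form by at most `t * √2 * K(Q)`. -/
lemma quadratic_homothety_le {n : ℕ} {Q : Matrix (Fin n) (Fin n) ℝ} (hQ : Q.IsSymm)
    {x z : EuclideanSpace ℝ (Fin n)} (hx : x ∈ stdSimplexE n) (hz : z ∈ stdSimplexE n)
    {t : ℝ} (ht0 : 0 ≤ t) (ht1 : t ≤ 1) :
    (AffineMap.homothety x t z).ofLp ⬝ᵥ Q *ᵥ (AffineMap.homothety x t z).ofLp ≤
      x.ofLp ⬝ᵥ Q *ᵥ x.ofLp + t * (√2 * (2 * ⨆ i : Fin n, √(∑ k, (Q k i) ^ 2))) := by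
  have hy : AffineMap.homothety x t z ∈ stdSimplexE n := by
    rw [AffineMap.homothety_eq_lineMap]
    exact (convex_stdSimplexE _).lineMap_mem hx hz ⟨ht0, ht1⟩
  set y := AffineMap.homothety x t z with hydef
  have hsub : y.ofLp - x.ofLp = t • (z.ofLp - x.ofLp) := by
    rw [hydef, AffineMap.homothety_apply]
    ext i
    simp
  have hsymm : x.ofLp ⬝ᵥ Q *ᵥ y.ofLp = y.ofLp ⬝ᵥ Q *ᵥ x.ofLp := by
    rw [dotProduct_mulVec, dotProduct_comm, ← mulVec_transpose, hQ.eq]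
  have hid : y.ofLp ⬝ᵥ Q *ᵥ y.ofLp - x.ofLp ⬝ᵥ Q *ᵥ x.ofLp =
      t * ((z.ofLp - x.ofLp) ⬝ᵥ Q *ᵥ y.ofLp + (z.ofLp - x.ofLp) ⬝ᵥ Q *ᵥ x.ofLp) := by
    rw [mul_add, ← smul_eq_mul, ← smul_eq_mul, ← smul_dotProduct, ← smul_dotProduct, ← hsub,
      sub_dotProduct, sub_dotProduct, hsymm]
    ring
  have := mul_le_mul_of_nonneg_left
    (add_le_add (sub_dotProduct_mulVec_le Q hx hz hy) (sub_dotProduct_mulVec_le Q hx hz hx)) ht0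
  linarith

lemma one_sub_pow_le_of_log_div_log_le {ρ φ : ℝ} (hρ0 : 0 < ρ) (hρ1 : ρ ≤ 1) (hφ0 : 0 < φ)
    {M : ℕ} (hM0 : 0 < M) (hM : Real.log φ / Real.log (1 - ρ) ≤ M) : (1 - ρ) ^ M ≤ φ := by
  rcases hρ1.eq_or_lt with rfl | hρ1
  · simp [hM0.ne', hφ0.le]
  · have hlog : Real.log (1 - ρ) < 0 := Real.log_neg (by linarith) (by linarith)
    rw [div_le_iff_of_neg hlog] at hM
    rw [← Real.log_le_log_iff (pow_pos (by linarith) M) hφ0, Real.log_pow]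
    exact hM

/-- The probability that at least one of `M` independent samples lands in `G`. -/
lemma one_sub_pow_le_pi_exists_mem {α : Type*} [MeasurableSpace α] (μ : Measure α)
    [IsProbabilityMeasure μ] {G : Set α} (hG : MeasurableSet G) {ρ : ℝ} (hρ1 : ρ ≤ 1)
    (hρ : ENNReal.ofReal ρ ≤ μ G) (M : ℕ) :
    ENNReal.ofReal (1 - (1 - ρ) ^ M) ≤
      Measure.pi (fun _ : Fin M => μ) {ω | ∃ i, ω i ∈ G} := by
  have hset : {ω : Fin M → α | ∃ i, ω i ∈ G} = (Set.univ.pi fun _ => Gᶜ)ᶜ := by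
    ext ω
    simp
  rw [hset, prob_compl_eq_one_sub (MeasurableSet.univ_pi fun _ => hG.compl), Measure.pi_pi,
    Finset.prod_const, Finset.card_univ, Fintype.card_fin, prob_compl_eq_one_sub hG,
    ENNReal.ofReal_sub _ (by have := sub_nonneg.2 hρ1; positivity), ENNReal.ofReal_one,
    ENNReal.ofReal_pow (sub_nonneg.2 hρ1)]
  refine tsub_le_tsub_left (pow_le_pow_left' ?_ M) 1
  rw [tsub_le_iff_right]
  calc (1 : ENNReal) = ENNReal.ofReal ((1 - ρ) + ρ) := by simp
    _ ≤ ENNReal.ofReal (1 - ρ) + ENNReal.ofReal ρ := ENNReal.ofReal_add_le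
    _ ≤ _ := by gcongr

theorem stmt8 {n : ℕ} (hn : 2 ≤ n)
    (Q : Matrix (Fin n) (Fin n) ℝ) (hQsymm : Q.IsSymm) (hQ0 : Q ≠ 0)
    (K γQ : ℝ)
    (hK : K = 2 * ⨆ i : Fin n, Real.sqrt (∑ k, (Q k i) ^ 2))
    (hγ : γQ = sInf ((fun δ : EuclideanSpace ℝ (Fin n) => δ ⬝ᵥ Q.mulVec δ) '' stdSimplexE n))
    (ε φ : ℝ) (hε0 : 0 < ε) (hεK : ε ≤ Real.sqrt 2 * K) (hφ0 : 0 < φ) (hφ1 : φ < 1)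
    (M : ℕ) (hM0 : 0 < M)
    (hM : (M : ℝ) ≥ Real.log φ / Real.log (1 - (ε / (Real.sqrt 2 * K)) ^ (n - 1))) :
    ENNReal.ofReal (1 - φ) ≤
      Measure.pi (fun _ : Fin M => uniformSimplex n)
        {ω : Fin M → EuclideanSpace ℝ (Fin n) |
          (⨅ i : Fin M, (ω i) ⬝ᵥ Q.mulVec (ω i)) - γQ ≤ ε} := by
  have hn0 : 0 < n := by omega
  have := isProbabilityMeasure_uniformSimplex hn0
  have hcont : Continuous fun δ : EuclideanSpace ℝ (Fin n) => δ.ofLp ⬝ᵥ Q *ᵥ δ.ofLp := by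
    fun_prop
  obtain ⟨x, hx, hxγ⟩ := (isCompact_stdSimplexE n).exists_sInf_image_eq
    (stdSimplexE_nonempty hn0) hcont.continuousOn
  rw [← hγ] at hxγ
  have hc : 0 < √2 * K := hε0.trans_le hεK
  set t := ε / (√2 * K) with ht
  have ht0 : 0 < t := div_pos hε0 hc
  have ht1 : t ≤ 1 := (div_le_one hc).2 hεK
  have hρ0 : 0 < t ^ (n - 1) := pow_pos ht0 _
  have hρ1 : t ^ (n - 1) ≤ 1 := pow_le_one₀ ht0.le ht1
  have hmeas : MeasurableSet (AffineMap.homothety x t '' stdSimplexE n) :=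
    ((isCompact_stdSimplexE _).image (AffineMap.homothety_continuous x t)).measurableSet
  calc ENNReal.ofReal (1 - φ) ≤ ENNReal.ofReal (1 - (1 - t ^ (n - 1)) ^ M) :=
        ENNReal.ofReal_le_ofReal <|
          sub_le_sub_left (one_sub_pow_le_of_log_div_log_le hρ0 hρ1 hφ0 hM0 hM) 1
    _ ≤ _ := one_sub_pow_le_pi_exists_mem (uniformSimplex n) hmeas hρ1
        (uniformSimplex_homothety hn0 hx ht0 ht1).ge M
    _ ≤ _ := by
        refine measure_mono ?_
        rintro ω ⟨i, z, hz, hi⟩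
        have hle := quadratic_homothety_le hQsymm hx hz ht0.le ht1
        rw [hi, ← hK, ht, div_mul_cancel₀ _ hc.ne', ← hxγ] at hle
        have hinf : (⨅ i : Fin M, (ω i).ofLp ⬝ᵥ Q *ᵥ (ω i).ofLp) ≤
            (ω i).ofLp ⬝ᵥ Q *ᵥ (ω i).ofLp :=
          ciInf_le (Set.finite_range _).bddBelow i
        simp only [Set.mem_ofPred_eq]
        linarith
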